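/- arXiv:2211.11643 — 5 statements merged into one kernel-verified Lean document; each statement's English description precedes it below -/
import Mathlib

section
/- For 0 < p₁ ≤ p₂ < 1, the Fisher–Rao geodesic distance on the manifold of geometric distributions satisfies d(p₁, p₂) = ∫_{p₁}^{p₂} 1/(p√(1−p)) dp = 2(artanh(√(1−p₁)) − artanh(√(1−p₂))), i.e. d(p₁, p₂) = 2|artanh(√(1−p₁)) − artanh(√(1−p₂))|. -/
/-- The inverse hyperbolic tangent, `artanh x = (1/2) log((1+x)/(1-x))`
(not yet in Mathlib). -/
noncomputable def artanh (x : ℝ) : ℝ := Real.log ((1 + x) / (1 - x)) / 2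

theorem hasDerivAt_artanh {x : ℝ} (h₁ : -1 < x) (h₂ : x < 1) :
    HasDerivAt artanh (1 / (1 - x ^ 2)) x := by
  have hadd : 1 + x ≠ 0 := by linarith
  have hsub : 1 - x ≠ 0 := by linarith
  have hsq : 1 - x ^ 2 ≠ 0 := by
    rw [show 1 - x ^ 2 = (1 + x) * (1 - x) by ring]
    exact mul_ne_zero hadd hsub
  have h := ((((hasDerivAt_id x).const_add 1).div ((hasDerivAt_id x).const_sub 1) hsub).log
    (div_ne_zero hadd hsub)).div_const 2
  refine h.congr_deriv ?_
  simp only [id, Pi.div_apply]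
  field_simp
  ring

theorem hasDerivAt_artanh_sqrt_one_sub {p : ℝ} (h₀ : 0 < p) (h₁ : p < 1) :
    HasDerivAt (fun p => -2 * artanh (Real.sqrt (1 - p))) (1 / (p * Real.sqrt (1 - p))) p := by
  have hpos : 0 < 1 - p := by linarith
  have hs : 0 < Real.sqrt (1 - p) := Real.sqrt_pos.2 hpos
  have hlt : Real.sqrt (1 - p) < 1 := by
    rw [Real.sqrt_lt' one_pos]
    linarith
  have h := ((hasDerivAt_artanh (by linarith) hlt).comp p
    (((hasDerivAt_id p).const_sub 1).sqrt hpos.ne')).const_mul (-2)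
  refine h.congr_deriv ?_
  simp only [id, Real.sq_sqrt hpos.le, sub_sub_cancel]
  field_simp

/-- Fisher–Rao geodesic distance on the manifold of geometric
distributions. -/
theorem geometric_fisher_rao_dist (p₁ p₂ : ℝ) (hp₁ : 0 < p₁) (h₁₂ : p₁ ≤ p₂)
    (hp₂ : p₂ < 1) :
    (∫ p in p₁..p₂, 1 / (p * Real.sqrt (1 - p)))
        = 2 * (artanh (Real.sqrt (1 - p₁)) - artanh (Real.sqrt (1 - p₂))) ∧
    2 * (artanh (Real.sqrt (1 - p₁)) - artanh (Real.sqrt (1 - p₂)))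
        = 2 * |artanh (Real.sqrt (1 - p₁)) - artanh (Real.sqrt (1 - p₂))| := by
  have hint : (∫ p in p₁..p₂, 1 / (p * Real.sqrt (1 - p)))
      = 2 * (artanh (Real.sqrt (1 - p₁)) - artanh (Real.sqrt (1 - p₂))) := by
    rw [intervalIntegral.integral_eq_sub_of_hasDerivAt
      (f := fun p => -2 * artanh (Real.sqrt (1 - p)))]
    · ring
    · intro p hp
      rw [Set.uIcc_of_le h₁₂] at hp
      exact hasDerivAt_artanh_sqrt_one_sub (hp₁.trans_le hp.1) (hp.2.trans_lt hp₂)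
    · refine ContinuousOn.intervalIntegrable ?_
      rw [Set.uIcc_of_le h₁₂]
      refine ContinuousOn.div (by fun_prop) (by fun_prop) fun p hp => ?_
      exact mul_ne_zero (hp₁.trans_le hp.1).ne'
        (Real.sqrt_pos.2 (by linarith [hp.2])).ne'
  refine ⟨hint, ?_⟩
  have hnonneg : 0 ≤ ∫ p in p₁..p₂, 1 / (p * Real.sqrt (1 - p)) :=
    intervalIntegral.integral_nonneg h₁₂ fun p hp =>
      one_div_nonneg.2 (mul_nonneg (hp₁.le.trans hp.1) (Real.sqrt_nonneg _))
  rw [abs_of_nonneg (by linarith)]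
end

section
/- For every κ > 0, the trigamma function satisfies ψ'(κ) > 1/κ, equivalently κψ'(κ) − 1 > 0. (This is exactly the positivity of the coefficient ψ'(κ) − 1/κ of dκ² in the Fisher–Rao metric of the Gamma family in (γ, κ) coordinates, hence the positive-definiteness of that metric.) -/
/-- The trigamma function `ψ' = (log Γ)''`. -/
noncomputable def trigamma (x : ℝ) : ℝ :=
  deriv (deriv (fun y : ℝ => Real.log (Real.Gamma y))) x

/-- The real Gamma function is smooth at every positive real. -/
theorem Real.contDiffAt_Gamma_of_pos {x : ℝ} (hx : 0 < x) {n : ℕ∞} :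
    ContDiffAt ℝ n Real.Gamma x := by
  have hopen : IsOpen {z : ℂ | 0 < z.re} := isOpen_lt continuous_const Complex.continuous_re
  have hdiff : DifferentiableOn ℂ Complex.Gamma {z : ℂ | 0 < z.re} := fun z hz =>
    (Complex.differentiableAt_Gamma z fun m h => by
      have hre : 0 < z.re := hz
      have hm : (0 : ℝ) ≤ m := m.cast_nonneg
      rw [h] at hre
      simp at hre
      linarith).differentiableWithinAt
  have hmem : {z : ℂ | 0 < z.re} ∈ nhds (x : ℂ) := hopen.mem_nhds (by simpa using hx)
  exact (hdiff.analyticAt hmem).contDiffAt.real_of_complex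

/-- The logarithm of the Gamma function is smooth at every positive real. -/
theorem Real.contDiffAt_log_Gamma_of_pos {x : ℝ} (hx : 0 < x) {n : ℕ∞} :
    ContDiffAt ℝ n (fun y => Real.log (Real.Gamma y)) x :=
  (Real.contDiffAt_Gamma_of_pos hx).log (Real.Gamma_pos_of_pos hx).ne'

theorem Real.differentiableAt_log_Gamma_of_pos {x : ℝ} (hx : 0 < x) :
    DifferentiableAt ℝ (fun y => Real.log (Real.Gamma y)) x :=
  (Real.contDiffAt_log_Gamma_of_pos (n := 1) hx).differentiableAt (by simp)

theorem Real.differentiableAt_deriv_log_Gamma_of_pos {x : ℝ} (hx : 0 < x) :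
    DifferentiableAt ℝ (deriv fun y => Real.log (Real.Gamma y)) x :=
  (ContDiffAt.derivWithin (n := 2) (m := 1) (Real.contDiffAt_log_Gamma_of_pos (n := 2) hx)
    (by norm_num)).differentiableAt (by simp)

theorem Real.deriv_log_Gamma_add_one {x : ℝ} (hx : 0 < x) :
    deriv (fun y => Real.log (Real.Gamma y)) (x + 1) =
      deriv (fun y => Real.log (Real.Gamma y)) x + x⁻¹ := by
  rw [← deriv_comp_add_const (fun y => Real.log (Real.Gamma y)) 1 x]
  have h : (fun y => Real.log (Real.Gamma (y + 1))) =ᶠ[nhds x]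
      fun y => Real.log (Real.Gamma y) + Real.log y := by
    filter_upwards [lt_mem_nhds hx] with y hy
    rw [Real.Gamma_add_one hy.ne', Real.log_mul hy.ne' (Real.Gamma_pos_of_pos hy).ne', add_comm]
  rw [h.deriv_eq, deriv_fun_add (Real.differentiableAt_log_Gamma_of_pos hx)
    (Real.differentiableAt_log hx.ne'), Real.deriv_log]

theorem trigamma_eq_add_trigamma_add_one {x : ℝ} (hx : 0 < x) :
    trigamma x = (x ^ 2)⁻¹ + trigamma (x + 1) := by
  unfold trigamma
  rw [← deriv_comp_add_const (deriv fun y => Real.log (Real.Gamma y)) 1 x]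
  have h : (fun y => deriv (fun y => Real.log (Real.Gamma y)) (y + 1)) =ᶠ[nhds x]
      fun y => deriv (fun y => Real.log (Real.Gamma y)) y + y⁻¹ := by
    filter_upwards [lt_mem_nhds hx] with y hy using Real.deriv_log_Gamma_add_one hy
  rw [h.deriv_eq, deriv_fun_add (Real.differentiableAt_deriv_log_Gamma_of_pos hx)
    (differentiableAt_inv hx.ne'), deriv_inv]
  ring

theorem trigamma_nonneg {x : ℝ} (hx : 0 < x) : 0 ≤ trigamma x := by
  have hmono : MonotoneOn (deriv fun y => Real.log (Real.Gamma y)) (Set.Ioi 0) :=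
    Real.convexOn_log_Gamma.monotoneOn_deriv fun y hy =>
      Real.differentiableAt_log_Gamma_of_pos hy
  have h := hmono.derivWithin_nonneg (x := x)
  rwa [derivWithin_of_isOpen isOpen_Ioi hx] at h

theorem inv_sub_inv_add_nat_le_trigamma (n : ℕ) {x : ℝ} (hx : 0 < x) :
    x⁻¹ - (x + n)⁻¹ ≤ trigamma x := by
  induction n generalizing x with
  | zero => simpa using trigamma_nonneg hx
  | succ n ih =>
    have h := ih (x := x + 1) (by linarith)
    have hstep : x⁻¹ - (x + 1)⁻¹ ≤ (x ^ 2)⁻¹ := by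
      rw [inv_sub_inv (by positivity) (by positivity), inv_eq_one_div,
        div_le_div_iff₀ (by positivity) (by positivity)]
      nlinarith
    rw [trigamma_eq_add_trigamma_add_one hx]
    push_cast
    rw [show x + (n + 1 : ℝ) = x + 1 + n by ring]
    linarith

theorem inv_le_trigamma {x : ℝ} (hx : 0 < x) : x⁻¹ ≤ trigamma x := by
  have hlim : Filter.Tendsto (fun n : ℕ => x⁻¹ - (x + n)⁻¹) Filter.atTop (nhds (x⁻¹ - 0)) :=
    (Filter.tendsto_atTop_add_const_left _ x
      tendsto_natCast_atTop_atTop).inv_tendsto_atTop.const_sub _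
  rw [sub_zero] at hlim
  exact le_of_tendsto' hlim fun n => inv_sub_inv_add_nat_le_trigamma n hx

theorem inv_lt_trigamma {x : ℝ} (hx : 0 < x) : x⁻¹ < trigamma x := by
  have h := inv_le_trigamma (x := x + 1) (by linarith)
  have hstep : x⁻¹ - (x + 1)⁻¹ < (x ^ 2)⁻¹ := by
    rw [inv_sub_inv (by positivity) (by positivity), inv_eq_one_div,
      div_lt_div_iff₀ (by positivity) (by positivity)]
    nlinarith
  rw [trigamma_eq_add_trigamma_add_one hx]
  linarith

/-- for every `κ > 0`, `ψ'(κ) > 1/κ`, equivalently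
`κψ'(κ) − 1 > 0`; this is the positivity of the coefficient of `dκ²` in the
Fisher–Rao metric of the Gamma family in `(γ, κ)` coordinates. -/
theorem trigamma_gt_inv (κ : ℝ) (hκ : 0 < κ) :
    1 / κ < trigamma κ ∧ 0 < κ * trigamma κ - 1 := by
  have h := inv_lt_trigamma hκ
  rw [← one_div] at h
  refine ⟨h, ?_⟩
  rw [div_lt_iff₀' hκ] at h
  linarith
end

section
/- For every κ > 0, the sectional curvature of the Fisher–Rao manifold of Gamma distributions, K(κ) = (ψ'(κ) + κψ''(κ))/(4(κψ'(κ) − 1)²), satisfies −1/2 < K(κ) < −1/4; in particular ψ'(κ) + κψ''(κ) < 0 and the Gamma manifold has everywhere negative sectional curvature depending only on the shape parameter κ. -/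
/-- The tetragamma function `ψ'' = (log Γ)'''`. -/
noncomputable def tetragamma (x : ℝ) : ℝ :=
  deriv (deriv (deriv (fun y : ℝ => Real.log (Real.Gamma y)))) x

open Filter Topology Set

/-! ### The polygamma series -/

/-- The series `∑ 1 / (x + n) ^ k`. -/
noncomputable def hurwitzSum (k : ℕ) (x : ℝ) : ℝ := ∑' n : ℕ, ((x + n) ^ k)⁻¹

lemma summable_inv_add_nat_pow {k : ℕ} (hk : 2 ≤ k) {x : ℝ} (hx : 0 < x) :
    Summable fun n : ℕ => ((x + n) ^ k)⁻¹ := by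
  rw [← summable_nat_add_iff 1]
  refine Summable.of_nonneg_of_le (fun n => by positivity) (fun n => ?_)
    ((summable_nat_add_iff 1).2 (Real.summable_nat_pow_inv.2 (by omega : 1 < k)))
  gcongr
  linarith

lemma hurwitzSum_add_one {k : ℕ} (hk : 2 ≤ k) {x : ℝ} (hx : 0 < x) :
    hurwitzSum k (x + 1) = hurwitzSum k x - (x ^ k)⁻¹ := by
  have h := (summable_inv_add_nat_pow hk hx).tsum_eq_zero_add
  simp only [Nat.cast_zero, add_zero, Nat.cast_add, Nat.cast_one] at h
  rw [hurwitzSum, hurwitzSum, h, add_sub_cancel_left]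
  exact tsum_congr fun n => by ring_nf

lemma tendsto_hurwitzSum_add_nat (k : ℕ) (x : ℝ) :
    Tendsto (fun N : ℕ => hurwitzSum k (x + N)) atTop (𝓝 0) := by
  refine (tendsto_sum_nat_add fun n : ℕ => ((x + n) ^ k)⁻¹).congr fun N => ?_
  exact tsum_congr fun n => by push_cast; ring_nf

lemma hasDerivAt_inv_add_pow (k : ℕ) {a x : ℝ} (h : x + a ≠ 0) :
    HasDerivAt (fun y : ℝ => ((y + a) ^ k)⁻¹) (-k * ((x + a) ^ (k + 1))⁻¹) x := by
  have h1 := (((hasDerivAt_id x).add_const a).pow k).inv (pow_ne_zero k h)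
  refine h1.congr_deriv ?_
  rcases k with _ | k
  · simp
  · simp only [id, Pi.pow_apply]
    rw [Nat.add_sub_cancel]
    push_cast
    field_simp
    ring

lemma hasDerivAt_hurwitzSum {k : ℕ} (hk : 2 ≤ k) {x : ℝ} (hx : 0 < x) :
    HasDerivAt (hurwitzSum k) (-k * hurwitzSum (k + 1) x) x := by
  have hmem : x ∈ Ioi (x / 2) := by simp only [mem_Ioi]; linarith
  have hsum := (summable_inv_add_nat_pow (by omega : 2 ≤ k + 1) (half_pos hx)).mul_left (k : ℝ)
  have h : HasDerivAt (fun y : ℝ => ∑' n : ℕ, ((y + n) ^ k)⁻¹)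
      (∑' n : ℕ, -(k : ℝ) * ((x + n) ^ (k + 1))⁻¹) x := by
    refine hasDerivAt_tsum_of_isPreconnected (g := fun (n : ℕ) (y : ℝ) => ((y + n) ^ k)⁻¹)
      (g' := fun (n : ℕ) (y : ℝ) => -(k : ℝ) * ((y + n) ^ (k + 1))⁻¹) (y₀ := x)
      hsum isOpen_Ioi isPreconnected_Ioi
      (fun n y hy => ?_) (fun n y hy => ?_) hmem (summable_inv_add_nat_pow hk hx) hmem
    · have : 0 < y := (half_pos hx).trans hy
      exact hasDerivAt_inv_add_pow k (by positivity)
    · have hy0 : 0 < y := (half_pos hx).trans hy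
      have hy' : x / 2 ≤ y := le_of_lt hy
      rw [neg_mul, norm_neg, Real.norm_of_nonneg (by positivity)]
      gcongr
  rwa [tsum_mul_left] at h

/-! ### Derivatives of `log Γ` -/

/-- The terms of the Weierstrass series of `log (x Γ(x))`. -/
noncomputable def weierstrassTerm (n : ℕ) (x : ℝ) : ℝ :=
  x * (Real.log (n + 2) - Real.log (n + 1)) - (Real.log (x + (n + 1)) - Real.log (n + 1))

/-- The derivatives of the terms of the Weierstrass series. -/
noncomputable def weierstrassDerivTerm (n : ℕ) (x : ℝ) : ℝ :=
  (Real.log (n + 2) - Real.log (n + 1)) - (x + (n + 1))⁻¹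

lemma hasDerivAt_weierstrassTerm (n : ℕ) {x : ℝ} (hx : 0 < x) :
    HasDerivAt (weierstrassTerm n) (weierstrassDerivTerm n x) x := by
  have h1 := (hasDerivAt_id x).mul_const (Real.log (n + 2) - Real.log (n + 1))
  have h2 := (((hasDerivAt_id x).add_const ((n : ℝ) + 1)).log
    (by simp only [id]; positivity)).sub_const (Real.log (n + 1))
  exact (h1.sub h2).congr_deriv (by simp [weierstrassDerivTerm])

lemma norm_weierstrassDerivTerm_le (n : ℕ) {x b : ℝ} (hx : 0 < x) (hb : x ≤ b) :
    ‖weierstrassDerivTerm n x‖ ≤ (b + 1) * ((1 + (n : ℝ)) ^ 2)⁻¹ := by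
  have hn : (0 : ℝ) < n + 1 := by positivity
  have hlog : Real.log (n + 2) - Real.log (n + 1) = Real.log ((n + 2) / (n + 1)) :=
    (Real.log_div (by positivity) hn.ne').symm
  have hup : Real.log (((n : ℝ) + 2) / (n + 1)) ≤ (n + 1 : ℝ)⁻¹ := by
    refine (Real.log_le_sub_one_of_pos (by positivity)).trans_eq ?_
    field_simp
    ring
  have hlo : ((n : ℝ) + 2)⁻¹ ≤ Real.log (((n : ℝ) + 2) / (n + 1)) := by
    refine le_trans (le_of_eq ?_) (Real.one_sub_inv_le_log_of_pos (by positivity))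
    field_simp
    ring
  have h1 : (n + 1 : ℝ)⁻¹ - (x + (n + 1))⁻¹ ≤ (b + 1) * ((1 + (n : ℝ)) ^ 2)⁻¹ := by
    have : (n + 1 : ℝ)⁻¹ - (x + (n + 1))⁻¹ = x * ((n + 1) * (x + (n + 1)))⁻¹ := by
      field_simp
      ring
    rw [this]
    have hsq : (1 + (n : ℝ)) ^ 2 ≤ (n + 1) * (x + (n + 1)) := by nlinarith
    gcongr <;> linarith
  have h2 : (x + ((n : ℝ) + 1))⁻¹ - ((n : ℝ) + 2)⁻¹ ≤ (b + 1) * ((1 + (n : ℝ)) ^ 2)⁻¹ := by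
    have h3 : (x + ((n : ℝ) + 1))⁻¹ ≤ ((n : ℝ) + 1)⁻¹ := inv_anti₀ hn (by linarith)
    have h4 : ((n : ℝ) + 1)⁻¹ - ((n : ℝ) + 2)⁻¹ = 1 * ((n + 1) * (n + 2 : ℝ))⁻¹ := by
      field_simp
      ring
    have h5 : 1 * ((n + 1) * (n + 2 : ℝ))⁻¹ ≤ (b + 1) * ((1 + (n : ℝ)) ^ 2)⁻¹ := by
      have hsq : (1 + (n : ℝ)) ^ 2 ≤ (n + 1) * (n + 2) := by nlinarith
      gcongr <;> linarith
    linarith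
  rw [weierstrassDerivTerm, hlog, Real.norm_eq_abs, abs_le]
  constructor <;> linarith

lemma summable_weierstrass_bound (b : ℝ) :
    Summable fun n : ℕ => (b + 1) * ((1 + (n : ℝ)) ^ 2)⁻¹ :=
  (summable_inv_add_nat_pow le_rfl one_pos).mul_left _

lemma weierstrassTerm_one (n : ℕ) : weierstrassTerm n 1 = 0 := by
  rw [weierstrassTerm, show (1 : ℝ) + (n + 1) = n + 2 by ring]
  ring

lemma summable_weierstrassTerm_one : Summable fun n => weierstrassTerm n 1 := by
  simpa only [weierstrassTerm_one] using summable_zero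

lemma summable_weierstrassTerm {x : ℝ} (hx : 0 < x) :
    Summable fun n => weierstrassTerm n x :=
  summable_of_summable_hasDerivAt_of_isPreconnected (t := Ioo 0 (x + 2)) (y₀ := 1)
    (summable_weierstrass_bound (x + 2)) isOpen_Ioo isPreconnected_Ioo
    (fun n _ hy => hasDerivAt_weierstrassTerm n hy.1)
    (fun n _ hy => norm_weierstrassDerivTerm_le n hy.1 hy.2.le)
    ⟨one_pos, by linarith⟩ summable_weierstrassTerm_one ⟨hx, by linarith⟩

lemma hasDerivAt_tsum_weierstrassTerm {x : ℝ} (hx : 0 < x) :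
    HasDerivAt (fun y => ∑' n, weierstrassTerm n y) (∑' n, weierstrassDerivTerm n x) x :=
  hasDerivAt_tsum_of_isPreconnected (t := Ioo 0 (x + 2)) (y₀ := 1)
    (summable_weierstrass_bound (x + 2)) isOpen_Ioo isPreconnected_Ioo
    (fun n _ hy => hasDerivAt_weierstrassTerm n hy.1)
    (fun n _ hy => norm_weierstrassDerivTerm_le n hy.1 hy.2.le)
    ⟨one_pos, by linarith⟩ summable_weierstrassTerm_one ⟨hx, by linarith⟩

lemma hasDerivAt_tsum_weierstrassDerivTerm {x : ℝ} (hx : 0 < x) :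
    HasDerivAt (fun y => ∑' n, weierstrassDerivTerm n y) (hurwitzSum 2 (x + 1)) x := by
  have hd (n : ℕ) (y : ℝ) (hy : 0 < y) :
      HasDerivAt (weierstrassDerivTerm n) (((y + 1 + n) ^ 2)⁻¹) y := by
    have h := (hasDerivAt_inv_add_pow 1 (a := (n : ℝ) + 1) (x := y) (by positivity)).const_sub
      (Real.log (n + 2) - Real.log (n + 1))
    simp only [pow_one] at h
    refine h.congr_deriv ?_
    rw [show y + ((n : ℝ) + 1) = y + 1 + n by ring]
    simp
  refine hasDerivAt_tsum_of_isPreconnected (t := Ioi 0) (y₀ := x)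
    (summable_inv_add_nat_pow le_rfl one_pos) isOpen_Ioi isPreconnected_Ioi
    hd (fun n y hy => ?_) hx ?_ hx
  · have hy0 : 0 < y := hy
    rw [Real.norm_of_nonneg (by positivity)]
    gcongr
    linarith
  · exact Summable.of_norm_bounded (summable_weierstrass_bound x)
      fun n => norm_weierstrassDerivTerm_le n hx le_rfl

lemma sum_range_weierstrassTerm (x : ℝ) (N : ℕ) :
    ∑ n ∈ Finset.range N, weierstrassTerm n x =
      Real.BohrMollerup.logGammaSeq x N + Real.log x
        + x * (Real.log (N + 1) - Real.log N) := by
  have hsum : ∀ N : ℕ, ∑ n ∈ Finset.range N, weierstrassTerm n x =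
      x * Real.log (N + 1) + Real.log N.factorial
        - ∑ n ∈ Finset.range N, Real.log (x + (n + 1)) := by
    intro N
    induction N with
    | zero => simp
    | succ N ih =>
      rw [Finset.sum_range_succ, Finset.sum_range_succ, ih, weierstrassTerm, Nat.factorial_succ,
        Nat.cast_mul, Real.log_mul (by positivity) (by positivity)]
      push_cast
      rw [show (N : ℝ) + 1 + 1 = N + 2 by ring]
      ring
  rw [hsum, Real.BohrMollerup.logGammaSeq, Finset.sum_range_succ']
  push_cast
  rw [add_zero]
  ring

lemma log_Gamma_eq_tsum {x : ℝ} (hx : 0 < x) :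
    Real.log (Real.Gamma x) = ∑' n, weierstrassTerm n x - Real.log x := by
  have h1 := (summable_weierstrassTerm hx).hasSum.tendsto_sum_nat
  have h2 := ((Real.BohrMollerup.tendsto_log_gamma hx).add_const (Real.log x)).add
    (Real.tendsto_log_nat_add_one_sub_log.const_mul x)
  simp only [← sum_range_weierstrassTerm] at h2
  have := tendsto_nhds_unique h1 h2
  linarith

lemma deriv_log_Gamma {x : ℝ} (hx : 0 < x) :
    deriv (fun y : ℝ => Real.log (Real.Gamma y)) x = ∑' n, weierstrassDerivTerm n x - x⁻¹ := by
  have h : (fun y : ℝ => Real.log (Real.Gamma y)) =ᶠ[𝓝 x]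
      fun y => ∑' n, weierstrassTerm n y - Real.log y :=
    (eventually_gt_nhds hx).mono fun y hy => log_Gamma_eq_tsum hy
  rw [h.deriv_eq]
  exact ((hasDerivAt_tsum_weierstrassTerm hx).sub (Real.hasDerivAt_log hx.ne')).deriv

lemma trigamma_eq_hurwitzSum {x : ℝ} (hx : 0 < x) : trigamma x = hurwitzSum 2 x := by
  have h : deriv (fun y : ℝ => Real.log (Real.Gamma y)) =ᶠ[𝓝 x]
      fun y => ∑' n, weierstrassDerivTerm n y - y⁻¹ :=
    (eventually_gt_nhds hx).mono fun y hy => deriv_log_Gamma hy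
  rw [trigamma, h.deriv_eq]
  refine ((hasDerivAt_tsum_weierstrassDerivTerm hx).sub (hasDerivAt_inv hx.ne')).deriv.trans ?_
  rw [hurwitzSum_add_one le_rfl hx]
  ring

lemma tetragamma_eq_hurwitzSum {x : ℝ} (hx : 0 < x) : tetragamma x = -2 * hurwitzSum 3 x := by
  have h : trigamma =ᶠ[𝓝 x] hurwitzSum 2 :=
    (eventually_gt_nhds hx).mono fun y hy => trigamma_eq_hurwitzSum hy
  change deriv trigamma x = _
  rw [h.deriv_eq, (hasDerivAt_hurwitzSum le_rfl hx).deriv]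
  norm_num

/-! ### The curvature inequalities by iterated differences -/

/-- A sequence of iterated unit shifts that strictly decreases to `0` starts at a positive value. -/
lemma pos_of_shift_lt {F : ℝ → ℝ} (hF : ∀ y, 0 < y → F (y + 1) < F y)
    (hlim : ∀ y, 0 < y → Tendsto (fun n : ℕ => F (y + n)) atTop (𝓝 0)) {x : ℝ} (hx : 0 < x) :
    0 < F x := by
  have hanti : StrictAnti fun n : ℕ => F (x + n) := strictAnti_nat_of_succ_lt fun n => by
    have := hF (x + n) (by positivity)
    rwa [add_assoc, ← Nat.cast_succ] at this
  have h1 := hanti.antitone.le_of_tendsto (hlim x hx) 1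
  have h2 := hF x hx
  simp only [Nat.cast_one] at h1
  linarith

lemma tendsto_comp_add_nat {f : ℝ → ℝ} {a : ℝ} (hf : Tendsto f atTop (𝓝 a)) (y : ℝ) :
    Tendsto (fun n : ℕ => f (y + n)) atTop (𝓝 a) :=
  hf.comp (tendsto_atTop_add_const_left _ _ tendsto_natCast_atTop_atTop)

/-- The quantity `(ψ'(x) + x ψ''(x) + c (x ψ'(x) - 1) ^ 2) / x ^ 2`. -/
noncomputable def curvatureGap (c x : ℝ) : ℝ :=
  -2 * hurwitzSum 3 x * x⁻¹ + hurwitzSum 2 x * x⁻¹ ^ 2 + c * (hurwitzSum 2 x - x⁻¹) ^ 2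

/-- The normalized first difference of `curvatureGap c`. -/
noncomputable def curvatureGapDiff (c x : ℝ) : ℝ :=
  -2 * hurwitzSum 3 x + hurwitzSum 2 x * ((1 + 2 * c) * x⁻¹ + (x + 1)⁻¹)
    + (-2 * x⁻¹ ^ 2 + x⁻¹ * (x + 1)⁻¹ - c * x⁻¹ * (x⁻¹ + x⁻¹ ^ 2 + (x + 1)⁻¹))

/-- The rational part of the normalized second difference of `curvatureGap c`. -/
noncomputable def curvatureRational (c x : ℝ) : ℝ :=
  ((8 + 4 * c) + (34 + 12 * c) * x + (59 + 21 * c) * x ^ 2 + (48 + 20 * c) * x ^ 3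
    + (17 + 10 * c) * x ^ 4 + (2 + 2 * c) * x ^ 5) /
    (x ^ 2 * (x + 1) ^ 2 * (x + 2) * ((2 + 2 * c) * x + (2 + 4 * c)))

lemma curvatureGap_sub_shift (c : ℝ) {x : ℝ} (hx : 0 < x) :
    curvatureGap c x - curvatureGap c (x + 1) = curvatureGapDiff c x / (x * (x + 1)) := by
  have : x + 1 ≠ 0 := by positivity
  rw [curvatureGap, curvatureGap, curvatureGapDiff, hurwitzSum_add_one le_rfl hx,
    hurwitzSum_add_one (by norm_num) hx]
  field_simp
  ring

lemma curvatureGapDiff_sub_shift {c : ℝ} (hc : 0 ≤ c) {x : ℝ} (hx : 0 < x) :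
    curvatureGapDiff c x - curvatureGapDiff c (x + 1) =
      (hurwitzSum 2 x - curvatureRational c x) *
        (((2 + 2 * c) * x + (2 + 4 * c)) / (x * (x + 1) * (x + 2))) := by
  have h1 : x + 1 ≠ 0 := by positivity
  have h2 : x + 2 ≠ 0 := by positivity
  have h3 : (2 + 2 * c) * x + (2 + 4 * c) ≠ 0 := by positivity
  rw [curvatureGapDiff, curvatureGapDiff, curvatureRational, hurwitzSum_add_one le_rfl hx,
    hurwitzSum_add_one (by norm_num) hx, show x + 1 + 1 = x + 2 by ring]
  field_simp
  ring

lemma tendsto_curvatureRational {c : ℝ} (hc : 0 ≤ c) :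
    Tendsto (curvatureRational c) atTop (𝓝 0) := by
  have hinv := tendsto_inv_atTop_zero (𝕜 := ℝ)
  have hlim : Tendsto (fun y : ℝ => (4 + 2 * c) * (y⁻¹ + y⁻¹ ^ 2)) atTop (𝓝 0) := by
    simpa using (hinv.add (hinv.pow 2)).const_mul (4 + 2 * c)
  refine squeeze_zero' ?_ ?_ hlim
  · filter_upwards [eventually_gt_atTop 0] with y hy
    rw [curvatureRational]
    positivity
  · filter_upwards [eventually_gt_atTop 0] with y hy
    rw [curvatureRational, div_le_iff₀ (by positivity), ← sub_nonneg]
    have : (4 + 2 * c) * (y⁻¹ + y⁻¹ ^ 2) *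
        (y ^ 2 * (y + 1) ^ 2 * (y + 2) * ((2 + 2 * c) * y + (2 + 4 * c))) =
        (4 + 2 * c) * ((y + 1) ^ 3 * (y + 2) * ((2 + 2 * c) * y + (2 + 4 * c))) := by
      field_simp
    rw [this]
    ring_nf
    positivity

lemma tendsto_curvatureGapDiff (c x : ℝ) :
    Tendsto (fun n : ℕ => curvatureGapDiff c (x + n)) atTop (𝓝 0) := by
  have hinv := tendsto_comp_add_nat (tendsto_inv_atTop_zero (𝕜 := ℝ)) x
  have hinv1 := tendsto_comp_add_nat ((tendsto_inv_atTop_zero (𝕜 := ℝ)).comp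
    (tendsto_atTop_add_const_right _ 1 tendsto_id)) x
  have h2 := tendsto_hurwitzSum_add_nat 2 x
  have h3 := tendsto_hurwitzSum_add_nat 3 x
  have h := ((h3.const_mul (-2)).add (h2.mul ((hinv.const_mul (1 + 2 * c)).add hinv1))).add
    ((((hinv.pow 2).const_mul (-2)).add (hinv.mul hinv1)).sub
      ((hinv.const_mul c).mul ((hinv.add (hinv.pow 2)).add hinv1)))
  simpa [curvatureGapDiff] using h

lemma tendsto_curvatureGap (c x : ℝ) :
    Tendsto (fun n : ℕ => curvatureGap c (x + n)) atTop (𝓝 0) := by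
  have hinv := tendsto_comp_add_nat (tendsto_inv_atTop_zero (𝕜 := ℝ)) x
  have h2 := tendsto_hurwitzSum_add_nat 2 x
  have h3 := tendsto_hurwitzSum_add_nat 3 x
  have h := (((h3.const_mul (-2)).mul hinv).add (h2.mul (hinv.pow 2))).add
    (((h2.sub hinv).pow 2).const_mul c)
  simpa [curvatureGap] using h

lemma tendsto_hurwitzSum_sub_curvatureRational {c : ℝ} (hc : 0 ≤ c) (x : ℝ) :
    Tendsto (fun n : ℕ => hurwitzSum 2 (x + n) - curvatureRational c (x + n)) atTop (𝓝 0) := by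
  simpa using (tendsto_hurwitzSum_add_nat 2 x).sub
    (tendsto_comp_add_nat (tendsto_curvatureRational hc) x)

lemma curvatureRational_two_sub_shift_lt {x : ℝ} (hx : 0 < x) :
    curvatureRational 2 x - curvatureRational 2 (x + 1) < (x ^ 2)⁻¹ := by
  have h : (x ^ 2)⁻¹ - (curvatureRational 2 x - curvatureRational 2 (x + 1)) =
      (1152 + 2928 * x + 3044 * x ^ 2 + 1584 * x ^ 3 + 404 * x ^ 4 + 40 * x ^ 5) /
        (x ^ 2 * (x + 1) ^ 2 * (x + 2) ^ 2 * (x + 3) ^ 2 * (6 * x + 10) * (6 * x + 16)) := by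
    rw [curvatureRational, curvatureRational, show x + 1 + 1 = x + 2 by ring,
      show x + 1 + 2 = x + 3 by ring]
    norm_num only
    rw [show 6 * (x + 1) + 10 = 6 * x + 16 by ring]
    field_simp
    ring
  have : 0 < (x ^ 2)⁻¹ - (curvatureRational 2 x - curvatureRational 2 (x + 1)) := by
    rw [h]
    positivity
  linarith

lemma lt_curvatureRational_one_sub_shift {x : ℝ} (hx : 0 < x) :
    (x ^ 2)⁻¹ < curvatureRational 1 x - curvatureRational 1 (x + 1) := by
  have h : curvatureRational 1 x - curvatureRational 1 (x + 1) - (x ^ 2)⁻¹ =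
      (1440 * x + 4470 * x ^ 2 + 5794 * x ^ 3 + 3972 * x ^ 4 + 1506 * x ^ 5 + 298 * x ^ 6
        + 24 * x ^ 7) /
        (x ^ 2 * (x + 1) ^ 2 * (x + 2) ^ 2 * (x + 3) ^ 2 * (4 * x + 6) * (4 * x + 10)) := by
    rw [curvatureRational, curvatureRational, show x + 1 + 1 = x + 2 by ring,
      show x + 1 + 2 = x + 3 by ring]
    norm_num only
    rw [show 4 * (x + 1) + 6 = 4 * x + 10 by ring]
    field_simp
    ring
  have : 0 < curvatureRational 1 x - curvatureRational 1 (x + 1) - (x ^ 2)⁻¹ := by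
    rw [h]
    positivity
  linarith

lemma curvatureGap_two_pos {x : ℝ} (hx : 0 < x) : 0 < curvatureGap 2 x := by
  have hK : ∀ y : ℝ, 0 < y → 0 < hurwitzSum 2 y - curvatureRational 2 y := fun y hy =>
    pos_of_shift_lt (F := fun y => hurwitzSum 2 y - curvatureRational 2 y)
      (fun z hz => by
        have := curvatureRational_two_sub_shift_lt hz
        simp only [hurwitzSum_add_one le_rfl hz]
        linarith)
      (fun z _ => tendsto_hurwitzSum_sub_curvatureRational zero_le_two z) hy
  have hH : ∀ y : ℝ, 0 < y → 0 < curvatureGapDiff 2 y := fun y hy =>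
    pos_of_shift_lt (fun z hz => by
      rw [← sub_pos, curvatureGapDiff_sub_shift zero_le_two hz]
      exact mul_pos (hK z hz) (by positivity)) (fun z _ => tendsto_curvatureGapDiff 2 z) hy
  exact pos_of_shift_lt (fun z hz => by
    rw [← sub_pos, curvatureGap_sub_shift 2 hz]
    exact div_pos (hH z hz) (by positivity)) (fun z _ => tendsto_curvatureGap 2 z) hx

lemma curvatureGap_one_neg {x : ℝ} (hx : 0 < x) : curvatureGap 1 x < 0 := by
  have hK : ∀ y : ℝ, 0 < y → hurwitzSum 2 y - curvatureRational 1 y < 0 := fun y hy =>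
    neg_pos.1 <| pos_of_shift_lt (F := fun y => -(hurwitzSum 2 y - curvatureRational 1 y))
      (fun z hz => by
        have := lt_curvatureRational_one_sub_shift hz
        simp only [hurwitzSum_add_one le_rfl hz]
        linarith)
      (fun z _ => by
        simpa only [neg_zero] using (tendsto_hurwitzSum_sub_curvatureRational zero_le_one z).neg) hy
  have hH : ∀ y : ℝ, 0 < y → curvatureGapDiff 1 y < 0 := fun y hy =>
    neg_pos.1 <| pos_of_shift_lt (F := fun y => -curvatureGapDiff 1 y) (fun z hz => by
      rw [neg_lt_neg_iff, ← sub_neg, curvatureGapDiff_sub_shift zero_le_one hz]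
      exact mul_neg_of_neg_of_pos (hK z hz) (by positivity))
      (fun z _ => by simpa only [neg_zero] using (tendsto_curvatureGapDiff 1 z).neg) hy
  exact neg_pos.1 <| pos_of_shift_lt (F := fun y => -curvatureGap 1 y) (fun z hz => by
    rw [neg_lt_neg_iff, ← sub_neg, curvatureGap_sub_shift 1 hz]
    exact div_neg_of_neg_of_pos (hH z hz) (by positivity))
    (fun z _ => by simpa only [neg_zero] using (tendsto_curvatureGap 1 z).neg) hx

lemma curvature_numerator_eq (c : ℝ) {x : ℝ} (hx : 0 < x) :
    trigamma x + x * tetragamma x + c * (x * trigamma x - 1) ^ 2 = x ^ 2 * curvatureGap c x := by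
  rw [trigamma_eq_hurwitzSum hx, tetragamma_eq_hurwitzSum hx, curvatureGap]
  field_simp
  ring

/-- the sectional curvature
`K(κ) = (ψ'(κ) + κψ''(κ))/(4(κψ'(κ) − 1)²)` of the Fisher–Rao manifold of
Gamma distributions satisfies `−1/2 < K(κ) < −1/4` for every `κ > 0`; in
particular `ψ'(κ) + κψ''(κ) < 0`. -/
theorem gamma_manifold_sectional_curvature_bounds (κ : ℝ) (hκ : 0 < κ) :
    -(1 / 2) < (trigamma κ + κ * tetragamma κ) / (4 * (κ * trigamma κ - 1) ^ 2) ∧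
    (trigamma κ + κ * tetragamma κ) / (4 * (κ * trigamma κ - 1) ^ 2) < -(1 / 4) ∧
    trigamma κ + κ * tetragamma κ < 0 := by
  have h2 := mul_pos (pow_pos hκ 2) (curvatureGap_two_pos hκ)
  have h1 := mul_neg_of_pos_of_neg (pow_pos hκ 2) (curvatureGap_one_neg hκ)
  rw [← curvature_numerator_eq _ hκ] at h1 h2
  have hu : 0 < (κ * trigamma κ - 1) ^ 2 := by linarith
  refine ⟨?_, ?_, by linarith⟩
  · rw [lt_div_iff₀ (by positivity)]
    linarith
  · rw [div_lt_iff₀ (by positivity)]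
    linarith
end

section
/- Let n ≥ 2, α ∈ (0,∞)ⁿ and v ∈ ℝⁿ with v ≠ 0. Then ∑_{i=1}^n ψ'(αᵢ)vᵢ² − ψ'(∑_{i=1}^n αᵢ)(∑_{i=1}^n vᵢ)² > 0; that is, the Fisher–Rao metric of the Dirichlet family, ds² = ∑ᵢ ψ'(αᵢ)dαᵢ² − ψ'(ᾱ)dᾱ² with ᾱ = ∑ᵢ αᵢ, is a positive-definite quadratic form on (0,∞)ⁿ, so it defines a Riemannian metric on the Dirichlet parameter manifold. -/
open Real Filter Topology

theorem hasSum_sub_succ_of_antitone_of_tendsto_zero {f : ℕ → ℝ} (hf : Antitone f)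
    (h0 : Tendsto f atTop (𝓝 0)) : HasSum (fun m => f m - f (m + 1)) (f 0) := by
  rw [hasSum_iff_tendsto_nat_of_nonneg fun m => sub_nonneg.2 (hf m.le_succ)]
  simp_rw [Finset.sum_range_sub']
  simpa using tendsto_const_nhds.sub h0

theorem summable_one_div_succ_sq : Summable fun m : ℕ => 1 / ((m : ℝ) + 1) ^ 2 := by
  have := (summable_nat_add_iff 1).2 (Real.summable_one_div_nat_pow.2 one_lt_two)
  simpa using this

theorem one_div_sub_one_div_add {a x : ℝ} (ha : 0 < a) (hx : 0 < x) :
    1 / a - 1 / (x + a) = x / (a * (x + a)) := by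
  field_simp
  ring

/-- The logarithm of the Weierstrass product of `Γ`. -/
theorem hasSum_log_Gamma {x : ℝ} (hx : 0 < x) :
    HasSum (fun m : ℕ => x / (m + 1) + log (m + 1) - log (x + (m + 1)))
      (log (Gamma x) + log x + eulerMascheroniConstant * x) := by
  rw [hasSum_iff_tendsto_nat_of_nonneg]
  · have h := ((BohrMollerup.tendsto_log_gamma hx).add_const (log x)).add
      (tendsto_harmonic_sub_log.mul_const x)
    refine h.congr fun n => ?_
    have hfac : log (n.factorial : ℝ) = ∑ m ∈ Finset.range n, log ((m : ℝ) + 1) := by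
      rw [← Finset.prod_range_add_one_eq_factorial, Nat.cast_prod, Real.log_prod]
      · simp
      · intro i _
        positivity
    have hharm : ((harmonic n : ℚ) : ℝ) * x = ∑ m ∈ Finset.range n, x / ((m : ℝ) + 1) := by
      simp [harmonic, div_eq_mul_inv, mul_comm x, Finset.sum_mul]
    rw [BohrMollerup.logGammaSeq, Finset.sum_range_succ', hfac, Finset.sum_sub_distrib,
      Finset.sum_add_distrib, ← hharm]
    push_cast
    rw [add_zero]
    ring
  · intro m
    have hm : (0 : ℝ) < m + 1 := by positivity
    have h := Real.log_le_sub_one_of_pos (show 0 < (x + (m + 1)) / (m + 1) by positivity)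
    rw [Real.log_div (by positivity) hm.ne', add_div, div_self hm.ne'] at h
    linarith

theorem hasDerivAt_log_Gamma {x : ℝ} (hx : 0 < x) :
    HasDerivAt (fun y => log (Gamma y))
      ((∑' m : ℕ, (1 / ((m : ℝ) + 1) - 1 / (x + (m + 1)))) - 1 / x
        - eulerMascheroniConstant) x := by
  have hd : HasDerivAt (fun y => ∑' m : ℕ, (y / ((m : ℝ) + 1) + log (m + 1) - log (y + (m + 1))))
      (∑' m : ℕ, (1 / ((m : ℝ) + 1) - 1 / (x + (m + 1)))) x := by
    refine hasDerivAt_tsum_of_isPreconnected (t := Set.Ioo 0 (x + 1)) (y₀ := x)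
      (g := fun (m : ℕ) (y : ℝ) => y / ((m : ℝ) + 1) + log (m + 1) - log (y + (m + 1)))
      (g' := fun (m : ℕ) (y : ℝ) => 1 / ((m : ℝ) + 1) - 1 / (y + (m + 1)))
      (summable_one_div_succ_sq.mul_left (x + 1)) isOpen_Ioo isPreconnected_Ioo ?_ ?_
      ⟨hx, by linarith⟩ ?_ ⟨hx, by linarith⟩
    · rintro m y ⟨hy, -⟩
      have hy' : y + ((m : ℝ) + 1) ≠ 0 := by positivity
      exact (((hasDerivAt_id y).div_const _).add_const _).sub
        (((hasDerivAt_id y).add_const _).log hy')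
    · rintro m y ⟨hy, hyx⟩
      have hm : (0 : ℝ) < m + 1 := by positivity
      rw [one_div_sub_one_div_add hm hy, Real.norm_of_nonneg (by positivity), mul_one_div, sq]
      gcongr ?_ / (_ * ?_)
      linarith
    · exact (hasSum_log_Gamma hx).summable
  refine ((hd.sub ((hasDerivAt_log hx.ne').add
    ((hasDerivAt_id x).const_mul eulerMascheroniConstant))).congr_of_eventuallyEq ?_).congr_deriv ?_
  · filter_upwards [Ioi_mem_nhds hx] with y hy
    simp only [Pi.sub_apply, Pi.add_apply, id_eq, (hasSum_log_Gamma hy).tsum_eq]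
    ring
  · simp only [one_div, mul_one]
    ring

theorem hasSum_trigamma {x : ℝ} (hx : 0 < x) :
    HasSum (fun m : ℕ => 1 / (x + m) ^ 2) (trigamma x) := by
  have hb : ∀ (m : ℕ) (y : ℝ), 0 < y →
      ‖1 / (y + ((m : ℝ) + 1)) ^ 2‖ ≤ 1 / ((m : ℝ) + 1) ^ 2 := by
    intro m y hy
    rw [Real.norm_of_nonneg (by positivity)]
    gcongr 1 / ?_ ^ 2
    linarith
  have hs : Summable fun m : ℕ => 1 / (x + ((m : ℝ) + 1)) ^ 2 :=
    .of_norm_bounded summable_one_div_succ_sq fun m => hb m x hx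
  have hd : HasDerivAt (fun y => ∑' m : ℕ, (1 / ((m : ℝ) + 1) - 1 / (y + (m + 1))))
      (∑' m : ℕ, 1 / (x + ((m : ℝ) + 1)) ^ 2) x := by
    refine hasDerivAt_tsum_of_isPreconnected (t := Set.Ioi 0) (y₀ := x)
      summable_one_div_succ_sq isOpen_Ioi isPreconnected_Ioi ?_ (fun m y hy => hb m y hy) hx ?_ hx
    · intro m y hy
      have hy' : y + ((m : ℝ) + 1) ≠ 0 := by
        have : 0 < y := hy
        positivity
      simpa [neg_div] using (((hasDerivAt_id y).add_const ((m : ℝ) + 1)).inv hy').const_sub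
        (1 / ((m : ℝ) + 1))
    · refine .of_nonneg_of_le (fun m => ?_) (fun m => ?_) (summable_one_div_succ_sq.mul_left x)
      · rw [sub_nonneg]
        gcongr 1 / ?_
        linarith
      · have hm : (0 : ℝ) < m + 1 := by positivity
        rw [one_div_sub_one_div_add hm hx, mul_one_div, sq]
        gcongr x / (_ * ?_)
        linarith
  have hT : trigamma x = (∑' m : ℕ, 1 / (x + ((m : ℝ) + 1)) ^ 2) + 1 / x ^ 2 := by
    refine HasDerivAt.deriv (((hd.sub (hasDerivAt_inv hx.ne')).sub_const
      eulerMascheroniConstant).congr_of_eventuallyEq ?_ |>.congr_deriv ?_)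
    · filter_upwards [Ioi_mem_nhds hx] with y hy
      simp [(hasDerivAt_log_Gamma hy).deriv]
    · ring
  rw [hT, ← hasSum_nat_add_iff' 1]
  simpa using hs.hasSum

theorem tendsto_one_div_add_nat_atTop (x : ℝ) :
    Tendsto (fun m : ℕ => 1 / (x + m)) atTop (𝓝 0) := by
  simp_rw [one_div]
  exact (tendsto_atTop_add_const_left _ x tendsto_natCast_atTop_atTop).inv_tendsto_atTop

theorem hasSum_one_div_mul_succ {x : ℝ} (hx : 0 < x) :
    HasSum (fun m : ℕ => 1 / ((x + m) * (x + m + 1))) (1 / x) := by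
  have h := hasSum_sub_succ_of_antitone_of_tendsto_zero (f := fun m : ℕ => 1 / (x + m))
    (antitone_nat_of_succ_le fun m => by gcongr; simp) (tendsto_one_div_add_nat_atTop x)
  simp only [Nat.cast_zero, add_zero] at h
  refine h.congr_fun fun m => ?_
  push_cast
  have : 0 < x + m := by positivity
  field_simp
  ring

/-- `ψ'(x) - 1/x - 1/(2x²)` as a series of positive decreasing functions. -/
theorem hasSum_trigamma_sub {x : ℝ} (hx : 0 < x) :
    HasSum (fun m : ℕ => 1 / (2 * ((x + m) * (x + m + 1)) ^ 2))
      (trigamma x - 1 / x - 1 / (2 * x ^ 2)) := by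
  have h := hasSum_sub_succ_of_antitone_of_tendsto_zero (f := fun m : ℕ => (1 / (x + m)) ^ 2)
    (antitone_nat_of_succ_le fun m => by gcongr; simp)
    (by simpa using (tendsto_one_div_add_nat_atTop x).pow 2)
  have h' := ((hasSum_trigamma hx).sub (hasSum_one_div_mul_succ hx)).sub (h.div_const 2)
  have hval : trigamma x - 1 / x - 1 / (2 * x ^ 2)
      = trigamma x - 1 / x - (1 / (x + ((0 : ℕ) : ℝ))) ^ 2 / 2 := by
    simp only [Nat.cast_zero, add_zero]
    field_simp
  rw [hval]
  refine h'.congr_fun fun m => ?_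
  have : 0 < x + m := by positivity
  push_cast
  rw [← add_assoc]
  field_simp
  ring

theorem trigamma_sub_lt {x : ℝ} (hx : 0 < x) :
    trigamma x - 1 / x - 1 / (2 * x ^ 2) < 1 / (2 * x ^ 2) := by
  have h := hasSum_le (fun m => ?_) (hasSum_trigamma_sub hx)
    ((hasSum_one_div_mul_succ hx).mul_left (1 / (2 * (x * (x + 1)))))
  · refine h.trans_lt ?_
    rw [one_div_mul_one_div]
    exact one_div_lt_one_div_of_lt (by positivity) (by nlinarith [pow_pos hx 3])
  · rw [one_div_mul_one_div, sq, ← mul_assoc]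
    have : (0 : ℝ) ≤ m := m.cast_nonneg
    gcongr <;> linarith

theorem mul_trigamma_lt {x y : ℝ} (hx : 0 < x) (hxy : x < y) :
    y * trigamma y < x * trigamma x := by
  have hy : 0 < y := hx.trans hxy
  have hle := hasSum_le (fun m => ?_) (hasSum_trigamma_sub hy) (hasSum_trigamma_sub hx)
  · have hlt := trigamma_sub_lt hy
    set R := trigamma y - 1 / y - 1 / (2 * y ^ 2) with hR
    have hty : y * trigamma y = 1 + 1 / (2 * y) + y * R := by
      rw [hR]
      field_simp
      ring
    have htx : x * trigamma x
        = 1 + 1 / (2 * x) + x * (trigamma x - 1 / x - 1 / (2 * x ^ 2)) := by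
      field_simp
      ring
    have hxR := mul_le_mul_of_nonneg_left hle hx.le
    have hRy : R < 1 / (2 * (x * y)) := hlt.trans (by gcongr; nlinarith)
    have hsub : 1 / (2 * x) - 1 / (2 * y) = (y - x) * (1 / (2 * (x * y))) := by
      field_simp
    have := mul_lt_mul_of_pos_left hRy (sub_pos.2 hxy)
    rw [hty, htx]
    linarith
  · gcongr

/-- the Fisher–Rao metric
`ds² = ∑ᵢ ψ'(αᵢ)dαᵢ² − ψ'(ᾱ)dᾱ²` of the Dirichlet family is a
positive-definite quadratic form on `(0,∞)ⁿ`. -/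
theorem dirichlet_fisher_metric_pos_def (n : ℕ) (hn : 2 ≤ n)
    (α : Fin n → ℝ) (hα : ∀ i, 0 < α i) (v : Fin n → ℝ) (hv : v ≠ 0) :
    0 < ∑ i, trigamma (α i) * v i ^ 2
        - trigamma (∑ i, α i) * (∑ i, v i) ^ 2 := by
  obtain ⟨j, hj⟩ := Function.ne_iff.1 hv
  have hA : 0 < ∑ i, α i := Finset.sum_pos (fun i _ => hα i) ⟨j, Finset.mem_univ j⟩
  have hlt : ∀ i, α i < ∑ k, α k := fun i => by
    have : Nontrivial (Fin n) := Fin.nontrivial_iff_two_le.2 hn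
    obtain ⟨k, hk⟩ := exists_ne i
    exact Finset.single_lt_sum hk (Finset.mem_univ i) (Finset.mem_univ k) (hα k)
      fun l _ _ => (hα l).le
  set A := ∑ i, α i with hAdef
  have ht : ∀ i, A * trigamma A / α i < trigamma (α i) := fun i => by
    rw [div_lt_iff₀ (hα i), mul_comm (trigamma _)]
    exact mul_trigamma_lt (hα i) (hlt i)
  have hTA : 0 ≤ trigamma A := (hasSum_trigamma hA).nonneg fun m => by positivity
  rw [sub_pos]
  calc trigamma A * (∑ i, v i) ^ 2
      = A * trigamma A * ((∑ i, v i) ^ 2 / A) := by field_simp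
    _ ≤ A * trigamma A * ∑ i, v i ^ 2 / α i := by
        gcongr
        exact Finset.sq_sum_div_le_sum_sq_div _ _ fun i _ => hα i
    _ = ∑ i, A * trigamma A / α i * v i ^ 2 := by
        rw [Finset.mul_sum]
        exact Finset.sum_congr rfl fun i _ => by ring
    _ < ∑ i, trigamma (α i) * v i ^ 2 :=
        Finset.sum_lt_sum (fun i _ => by have := (ht i).le; gcongr)
          ⟨j, Finset.mem_univ j, mul_lt_mul_of_pos_right (ht j) (sq_pos_of_ne_zero hj)⟩
end

section
/- Let I ⊆ ℝ be an interval, t₀ ∈ I, and let γ, κ : I → (0,∞) be twice continuously differentiable functions satisfying the first geodesic equation of the Gamma manifold, γ''(t) = γ'(t)²/γ(t) − γ'(t)κ'(t)/κ(t) for all t ∈ I. If γ'(t₀) = 0, then γ' vanishes identically on I, i.e. γ is constant: a geodesic of the Gamma manifold with horizontal initial direction (constant-γ direction) stays horizontal. -/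
/-- A real function whose derivative within an interval vanishes is constant on that interval. -/
theorem Set.OrdConnected.eq_of_hasDerivWithinAt_zero {I : Set ℝ} (hI : I.OrdConnected)
    {f : ℝ → ℝ} (hf : ∀ t ∈ I, HasDerivWithinAt f 0 I t) {s t : ℝ} (hs : s ∈ I) (ht : t ∈ I) :
    f t = f s := by
  have h := hI.convex.norm_image_sub_le_of_norm_hasDerivWithin_le (C := 0) hf (by simp) hs ht
  simpa [sub_eq_zero] using h

/-- a geodesic of the Gamma manifold with horizontal initial
direction stays horizontal: if twice continuously differentiable curves
`γ, κ : I → (0,∞)` satisfy the first geodesic equation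
`γ'' = γ'²/γ − γ'κ'/κ` on an interval `I` and `γ'(t₀) = 0` for some `t₀ ∈ I`,
then `γ' ≡ 0` on `I`, i.e. `γ` is constant on `I`. -/
theorem gamma_geodesic_horizontal_stays_horizontal
    (I : Set ℝ) (hI : I.OrdConnected) (t₀ : ℝ) (ht₀ : t₀ ∈ I)
    (γ κ γ' κ' γ'' κ'' : ℝ → ℝ)
    (hγpos : ∀ t ∈ I, 0 < γ t) (hκpos : ∀ t ∈ I, 0 < κ t)
    -- γ and κ are twice continuously differentiable on I
    (hdγ : ∀ t ∈ I, HasDerivWithinAt γ (γ' t) I t)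
    (hdκ : ∀ t ∈ I, HasDerivWithinAt κ (κ' t) I t)
    (hdγ' : ∀ t ∈ I, HasDerivWithinAt γ' (γ'' t) I t)
    (hdκ' : ∀ t ∈ I, HasDerivWithinAt κ' (κ'' t) I t)
    (hcγ'' : ContinuousOn γ'' I) (hcκ'' : ContinuousOn κ'' I)
    -- first geodesic equation of the Gamma manifold
    (hgeo : ∀ t ∈ I, γ'' t = (γ' t) ^ 2 / γ t - γ' t * κ' t / κ t)
    -- horizontal initial direction
    (h₀ : γ' t₀ = 0) :
    (∀ t ∈ I, γ' t = 0) ∧ ∀ t ∈ I, γ t = γ t₀ := by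
  -- The momentum `κ γ' / γ` is conserved.
  have h_momentum : ∀ t ∈ I, HasDerivWithinAt (fun s => κ s * γ' s / γ s) 0 I t := by
    intro t ht
    have hγ := (hγpos t ht).ne'
    have hκ := (hκpos t ht).ne'
    refine (((hdκ t ht).mul (hdγ' t ht)).div (hdγ t ht) hγ).congr_deriv ?_
    rw [Pi.mul_apply, hgeo t ht]
    field_simp
    ring
  have h_zero : ∀ t ∈ I, γ' t = 0 := by
    intro t ht
    have h := hI.eq_of_hasDerivWithinAt_zero h_momentum ht₀ ht
    simpa [h₀, (hγpos t ht).ne', (hκpos t ht).ne'] using h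
  exact ⟨h_zero, fun t ht => hI.eq_of_hasDerivWithinAt_zero
    (fun s hs => h_zero s hs ▸ hdγ s hs) ht₀ ht⟩
end
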